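/- Canonical diagrams of permutations: for every permutation σ in the symmetric group S_n there exists an irreducible word w over {s_1, …, s_{n-1}} with eval(w) = σ, and this irreducible word is unique up to the interchange equivalence ≈ (any two irreducible words evaluating to σ are ≈-equivalent). -/

import Mathlib

/-!
Fix `n ≥ 1`; we write `n = m + 1` where `m : ℕ`, so that words are lists over the
alphabet `{s_1, …, s_{n-1}}`, formalized as `List (Fin m)`: the letter `i : Fin m`
denotes the adjacent transposition `(i, i+1)` of `Fin (m+1)`.
-/

/-- Words over the alphabet `{s_1, …, s_{n-1}}` with `n = m + 1`. -/
abbrev Word (m : ℕ) := List (Fin m)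

/-- The letter `s_i` as the adjacent transposition `(i, i+1)` of `{1, …, n}`. -/
def toSwap {m : ℕ} (i : Fin m) : Equiv.Perm (Fin (m + 1)) :=
  Equiv.swap i.castSucc i.succ

/-- Evaluation of a word: the composite of the transpositions taken in the order
in which they occur in the word (the leftmost letter is applied first). -/
def eval {m : ℕ} (w : Word m) : Equiv.Perm (Fin (m + 1)) :=
  (w.map toSwap).reverse.prod

/-- The interchange equivalence `≈`: the smallest congruence on words (compatible
with concatenation) generated by `s_i s_j ≈ s_j s_i` whenever `|i - j| ≥ 2`. -/
inductive Interchange {m : ℕ} : Word m → Word m → Prop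
  | swap (u v : Word m) (i j : Fin m)
      (h : (i : ℕ) + 2 ≤ (j : ℕ) ∨ (j : ℕ) + 2 ≤ (i : ℕ)) :
      Interchange (u ++ [i, j] ++ v) (u ++ [j, i] ++ v)
  | refl (w : Word m) : Interchange w w
  | symm {w w' : Word m} : Interchange w w' → Interchange w' w
  | trans {w₁ w₂ w₃ : Word m} :
      Interchange w₁ w₂ → Interchange w₂ w₃ → Interchange w₁ w₃

/-- The rules of the rewriting system `𝔖`:
`s_i s_i ⇒ ε` and `s_i s_{i+1} s_i ⇒ s_{i+1} s_i s_{i+1}`. -/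
inductive Rule {m : ℕ} : Word m → Word m → Prop
  | del (i : Fin m) : Rule [i, i] []
  | yb (i j : Fin m) (h : (j : ℕ) = (i : ℕ) + 1) : Rule [i, j, i] [j, i, j]

/-- One rewriting step of `𝔖`, applied inside an arbitrary context and modulo `≈`:
`w ⇒ w'` iff `w ≈ u·l·v` and `w' ≈ u·r·v` for some rule `l ⇒ r` and words `u, v`. -/
def Step {m : ℕ} (w w' : Word m) : Prop :=
  ∃ u v l r, Rule l r ∧ Interchange w (u ++ l ++ v) ∧ Interchange w' (u ++ r ++ v)

/-- A word is irreducible if no word `≈`-equivalent to it contains the left-hand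
side of a rule as a factor. -/
def IrreducibleWord {m : ℕ} (w : Word m) : Prop :=
  ∀ u v l r : Word m, Rule l r → ¬ Interchange w (u ++ l ++ v)

namespace Interchange

variable {m : ℕ}

theorem append_left (a : Word m) {w w' : Word m} (h : Interchange w w') :
    Interchange (a ++ w) (a ++ w') := by
  induction h with
  | swap u v i j h => simpa using Interchange.swap (a ++ u) v i j h
  | refl w => exact .refl _
  | symm _ ih => exact ih.symm
  | trans _ _ ih₁ ih₂ => exact ih₁.trans ih₂

theorem append_right (c : Word m) {w w' : Word m} (h : Interchange w w') :
    Interchange (w ++ c) (w' ++ c) := by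
  induction h with
  | swap u v i j h => simpa using Interchange.swap u (v ++ c) i j h
  | refl w => exact .refl _
  | symm _ ih => exact ih.symm
  | trans _ _ ih₁ ih₂ => exact ih₁.trans ih₂

theorem perm {w w' : Word m} (h : Interchange w w') : w.Perm w' := by
  induction h with
  | swap u v i j h => exact ((List.Perm.swap j i []).append_left u).append_right v
  | refl w => exact .refl _
  | symm _ ih => exact ih.symm
  | trans _ _ ih₁ ih₂ => exact ih₁.trans ih₂

/-- A letter commutes past a word all of whose letters are at distance at least two above it. -/
theorem cons_append_singleton (i : Fin m) (b : Word m)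
    (hb : ∀ x ∈ b, (i : ℕ) + 2 ≤ (x : ℕ)) : Interchange (i :: b) (b ++ [i]) := by
  induction b with
  | nil => exact .refl _
  | cons x b ih =>
    have h₁ : Interchange (i :: x :: b) (x :: i :: b) := by
      simpa using Interchange.swap [] b i x (Or.inl (hb x (by simp)))
    have h₂ := (ih fun y hy => hb y (by simp [hy])).append_left [x]
    exact h₁.trans (by simpa using h₂)

end Interchange

theorem IrreducibleWord.factor {m : ℕ} {w a b c : Word m} (hw : IrreducibleWord w)
    (h : Interchange w (a ++ b ++ c)) : IrreducibleWord b := by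
  intro u v l r hr hb
  refine hw (a ++ u) (v ++ c) l r hr (h.trans ?_)
  simpa using (hb.append_left a).append_right c

section Evaluation

variable {m : ℕ}

theorem eval_append (u v : Word m) : eval (u ++ v) = eval v * eval u := by
  simp [eval]

theorem eval_cons (i : Fin m) (w : Word m) : eval (i :: w) = eval w * toSwap i := by
  simp [eval]

theorem toSwap_mul_comm {i j : Fin m} (h : (i : ℕ) + 2 ≤ (j : ℕ) ∨ (j : ℕ) + 2 ≤ (i : ℕ)) :
    toSwap i * toSwap j = toSwap j * toSwap i := by
  apply Equiv.Perm.Disjoint.commute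
  intro x
  by_cases hx : x = i.castSucc ∨ x = i.succ
  · right
    apply Equiv.swap_apply_of_ne_of_ne <;>
      · rcases hx with rfl | rfl <;> · simp [Fin.ext_iff]; omega
  · left
    push Not at hx
    exact Equiv.swap_apply_of_ne_of_ne hx.1 hx.2

theorem eval_eq_of_interchange {w w' : Word m} (h : Interchange w w') : eval w = eval w' := by
  induction h with
  | swap u v i j h =>
    have hij : eval [i, j] = eval [j, i] := by
      simpa [eval] using (toSwap_mul_comm h).symm
    simp only [eval_append, hij]
  | refl w => rfl
  | symm _ ih => exact ih.symm
  | trans _ _ ih₁ ih₂ => exact ih₁.trans ih₂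

theorem eval_eq_of_rule {l r : Word m} (h : Rule l r) : eval l = eval r := by
  cases h with
  | del i => simp [eval, toSwap]
  | yb i j h =>
    have hij : j.castSucc = i.succ := by simp [Fin.ext_iff, h]
    have h₁ : i.castSucc ≠ i.succ := by simp [Fin.ext_iff]
    have h₂ : i.castSucc ≠ j.succ := by simp [Fin.ext_iff]; omega
    have h₃ : i.succ ≠ j.succ := by simp [Fin.ext_iff]; omega
    have e₁ := Equiv.swap_mul_swap_mul_swap h₃.symm h₂.symm
    have e₂ := Equiv.swap_mul_swap_mul_swap h₁ h₂
    simp only [eval, toSwap, List.map_cons, List.map_nil, List.reverse_cons, List.reverse_nil,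
      List.nil_append, List.cons_append, List.prod_cons, List.prod_nil, mul_one, hij, ← mul_assoc]
    rw [Equiv.swap_comm i.castSucc i.succ, Equiv.swap_comm i.succ j.succ, e₁,
      Equiv.swap_comm j.succ i.succ, Equiv.swap_comm i.succ i.castSucc, e₂, Equiv.swap_comm]

theorem exists_eval_eq (σ : Equiv.Perm (Fin (m + 1))) : ∃ w : Word m, eval w = σ := by
  have hσ : σ ∈ Submonoid.closure (Set.range fun i : Fin m => Equiv.swap i.castSucc i.succ) := by
    rw [Equiv.Perm.mclosure_swap_castSucc_succ]; trivial
  induction hσ using Submonoid.closure_induction with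
  | mem x hx =>
    obtain ⟨i, rfl⟩ := hx
    exact ⟨[i], by simp [eval, toSwap]⟩
  | one => exact ⟨[], rfl⟩
  | mul x y _ _ hx hy =>
    obtain ⟨u, rfl⟩ := hx
    obtain ⟨v, rfl⟩ := hy
    exact ⟨v ++ u, eval_append v u⟩

theorem eval_apply_of_le {k : ℕ} (w : Word m) (hw : ∀ x ∈ w, k + 1 ≤ (x : ℕ))
    (p : Fin (m + 1)) (hp : (p : ℕ) ≤ k) : eval w p = p := by
  induction w with
  | nil => rfl
  | cons i w ih =>
    have hi := hw i (by simp)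
    have : toSwap i p = p := by
      apply Equiv.swap_apply_of_ne_of_ne <;> · simp [Fin.ext_iff]; omega
    rw [eval_cons, Equiv.Perm.mul_apply, this, ih fun x hx => hw x (by simp [hx])]

end Evaluation

/-- A weight on words that every rewriting step of `𝔖` strictly decreases. -/
def weight {m : ℕ} (w : Word m) : ℕ := (w.map fun i : Fin m => m - (i : ℕ)).sum

theorem weight_append {m : ℕ} (u v : Word m) : weight (u ++ v) = weight u + weight v := by
  simp [weight]

theorem Rule.weight_lt {m : ℕ} {l r : Word m} (h : Rule l r) : weight r < weight l := by
  cases h with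
  | del i => have := i.isLt; simp [weight]
  | yb i j h => have := j.isLt; simp [weight]; omega

theorem exists_irreducibleWord {m : ℕ} (σ : Equiv.Perm (Fin (m + 1))) :
    ∃ w : Word m, IrreducibleWord w ∧ eval w = σ := by
  obtain ⟨w, hw⟩ := exists_eval_eq σ
  induction hN : weight w using Nat.strong_induction_on generalizing w with
  | _ N ih =>
    by_cases h : IrreducibleWord w
    · exact ⟨w, h, hw⟩
    · simp only [IrreducibleWord, not_forall, not_not] at h
      obtain ⟨u, v, l, r, hr, hi⟩ := h
      have hwt : weight w = weight (u ++ l ++ v) :=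
        (hi.perm.map fun i : Fin m => m - (i : ℕ)).sum_eq
      refine ih (weight (u ++ r ++ v)) ?_ (u ++ r ++ v) ?_ rfl
      · have := hr.weight_lt
        simp only [weight_append] at hwt ⊢
        omega
      · rw [← hw, eval_eq_of_interchange hi]
        simp [eval_append, eval_eq_of_rule hr]

/-- `AscendingRun k s` says that `s` is the word `s_k s_{k+1} ⋯ s_{k+d-1}` for some `d`. -/
inductive AscendingRun {m : ℕ} : ℕ → Word m → Prop
  | nil (k : ℕ) : AscendingRun k []
  | cons (i : Fin m) {s : Word m} (h : AscendingRun ((i : ℕ) + 1) s) :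
      AscendingRun (i : ℕ) (i :: s)

namespace AscendingRun

variable {m k : ℕ}

theorem le_of_mem {s : Word m} (h : AscendingRun k s) : ∀ x ∈ s, k ≤ (x : ℕ) := by
  induction h with
  | nil k => simp
  | cons i h ih =>
    intro x hx
    rcases List.mem_cons.1 hx with rfl | hx
    · exact le_rfl
    · exact (Nat.le_succ _).trans (ih x hx)

theorem eval_apply {s : Word m} (h : AscendingRun k s) (p : Fin (m + 1)) (hp : (p : ℕ) = k) :
    (eval s p : ℕ) = k + s.length := by
  induction h generalizing p with
  | nil k => simpa [eval] using hp
  | cons i h ih =>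
    obtain rfl : p = i.castSucc := Fin.ext hp
    have : toSwap i i.castSucc = i.succ := Equiv.swap_apply_left _ _
    rw [eval_cons, Equiv.Perm.mul_apply, this, ih i.succ (by simp)]
    simp only [List.length_cons]
    omega

theorem eq_of_length_eq {s t : Word m} (hs : AscendingRun k s) (ht : AscendingRun k t)
    (h : s.length = t.length) : s = t := by
  induction hs generalizing t with
  | nil k => exact (List.length_eq_zero_iff.1 h.symm).symm
  | @cons i s hs ih =>
    generalize hk : (i : ℕ) = k at ht
    cases ht with
    | nil => simp at h
    | cons j ht =>
      obtain rfl : i = j := Fin.ext hk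
      rw [ih ht (by simpa using h)]

end AscendingRun

/-- An irreducible word with letters `≥ k` is equivalent to
a word with letters `> k` followed by an ascending run starting at `k`. -/
theorem IrreducibleWord.exists_interchange_append {m : ℕ} (k : ℕ) (w : Word m)
    (hw : IrreducibleWord w) (hk : ∀ x ∈ w, k ≤ (x : ℕ)) :
    ∃ u s : Word m, (∀ x ∈ u, k + 1 ≤ (x : ℕ)) ∧ AscendingRun k s ∧ Interchange w (u ++ s) := by
  induction hd : m - k generalizing k w with
  | zero =>
    refine ⟨[], [], by simp, .nil k, ?_⟩
    cases w with
    | nil => exact .refl _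
    | cons x w => have := hk x (by simp); omega
  | succ d ihd =>
    induction w with
    | nil => exact ⟨[], [], by simp, .nil k, .refl _⟩
    | cons x w ihw =>
      have hw' : IrreducibleWord w := hw.factor (a := [x]) (c := []) (by simpa using .refl _)
      obtain ⟨u, s, hu, hs, hus⟩ := ihw hw' fun y hy => hk y (by simp [hy])
      have hxus : Interchange (x :: w) (x :: (u ++ s)) := hus.append_left [x]
      rcases (hk x (by simp)).eq_or_lt with rfl | hx
      · have hu' : IrreducibleWord u :=
          hw.factor (a := [x]) (c := s) (by simpa using hxus)
        obtain ⟨v, t, hv, ht, hvt⟩ := ihd (x + 1) u hu' hu (by omega)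
        have hxv := (Interchange.cons_append_singleton x v hv).append_right (t ++ s)
        have key : Interchange (x :: w) (v ++ [x] ++ t ++ s) := by
          refine hxus.trans ?_
          have h := (hvt.append_left [x]).append_right s
          simp only [List.append_assoc, List.cons_append, List.nil_append] at h hxv ⊢
          exact h.trans hxv
        generalize hkx : (x : ℕ) = k at hs
        cases hs with
        | nil =>
          subst hkx
          refine ⟨v, x :: t, fun y hy => (Nat.le_succ _).trans (hv y hy), .cons x ht, ?_⟩
          simpa using key
        | @cons i s hs =>
          obtain rfl : x = i := Fin.ext hkx
          exfalso
          generalize hkx' : (x : ℕ) + 1 = k at ht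
          cases ht with
          | nil => exact hw v s _ _ (.del x) (by simpa using key)
          | @cons j t ht =>
            have hxt := (Interchange.cons_append_singleton x t fun y hy => by
              have := ht.le_of_mem y hy; omega).symm
            have h := (hxt.append_left (v ++ [x, j])).append_right s
            refine hw v (t ++ s) _ _ (.yb x j hkx'.symm) (key.trans ?_)
            simpa using h
      · refine ⟨x :: u, s, fun y hy => ?_, hs, hxus⟩
        rcases List.mem_cons.1 hy with rfl | hy
        · exact hx
        · exact hu y hy

theorem IrreducibleWord.interchange_of_eval_eq {m : ℕ} (k : ℕ) {w w' : Word m}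
    (hw : IrreducibleWord w) (hw' : IrreducibleWord w') (hk : ∀ x ∈ w, k ≤ (x : ℕ))
    (hk' : ∀ x ∈ w', k ≤ (x : ℕ)) (h : eval w = eval w') : Interchange w w' := by
  induction hd : m - k generalizing k w w' with
  | zero =>
    have nil_of_le : ∀ v : Word m, (∀ x ∈ v, k ≤ (x : ℕ)) → v = [] := fun v hv =>
      List.eq_nil_iff_forall_not_mem.2 fun x hx => by have := hv x hx; omega
    rw [nil_of_le w hk, nil_of_le w' hk']
    exact .refl _
  | succ d ih =>
    obtain ⟨u, s, hu, hs, hus⟩ := hw.exists_interchange_append k w hk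
    obtain ⟨u', s', hu', hs', hus'⟩ := hw'.exists_interchange_append k w' hk'
    rw [eval_eq_of_interchange hus, eval_eq_of_interchange hus', eval_append, eval_append] at h
    let p : Fin (m + 1) := ⟨k, by omega⟩
    have hp := congrArg (fun σ : Equiv.Perm (Fin (m + 1)) => (σ p : ℕ)) h
    simp only [Equiv.Perm.mul_apply, eval_apply_of_le u hu p le_rfl,
      eval_apply_of_le u' hu' p le_rfl, hs.eval_apply p rfl, hs'.eval_apply p rfl] at hp
    obtain rfl := hs.eq_of_length_eq hs' (by omega)
    have huu' := ih (k + 1)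
      (hw.factor (a := []) (c := s) (by simpa using hus))
      (hw'.factor (a := []) (c := s) (by simpa using hus'))
      hu hu' (mul_left_cancel h) (by omega)
    exact hus.trans ((huu'.append_right s).trans hus'.symm)

/-- Canonical diagrams of permutations: for every permutation
`σ ∈ S_n` there exists an irreducible word `w` with `eval w = σ`, and this
irreducible word is unique up to the interchange equivalence `≈`. -/
theorem canonical_diagram {m : ℕ} (σ : Equiv.Perm (Fin (m + 1))) :
    (∃ w : Word m, IrreducibleWord w ∧ eval w = σ) ∧
      (∀ w w' : Word m, IrreducibleWord w → IrreducibleWord w' →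
        eval w = σ → eval w' = σ → Interchange w w') :=
  ⟨exists_irreducibleWord σ, fun _ _ hw hw' h h' =>
    hw.interchange_of_eval_eq 0 hw' (by simp) (by simp) (h.trans h'.symm)⟩
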